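/- arXiv:1411.5430 — 2 statements merged into one kernel-verified Lean document; each statement's English description precedes it below -/
import Mathlib

section
/- Let P be a Perm algebra and L a Lie algebra, both over a field k of characteristic zero. Then the tensor product P ⊗ L equipped with the bilinear operation (p⊗a) ⊢ (q⊗b) = pq ⊗ [a,b] is a left Leibniz algebra, i.e. x ⊢ (y ⊢ z) = (x ⊢ y) ⊢ z + y ⊢ (x ⊢ z) holds for all x, y, z in P ⊗ L. -/
open scoped TensorProduct

/-- If `P` is a Perm algebra and `L` a Lie algebra over a field `k` of
characteristic zero, then `P ⊗ L` with the bilinear operation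
`(p⊗a) ⊢ (q⊗b) = pq ⊗ [a,b]` is a left Leibniz algebra. -/
theorem stmt1 {k : Type*} [Field k] [CharZero k]
    {P : Type*} [NonUnitalRing P] [Module k P] [SMulCommClass k P P] [IsScalarTower k P P]
    (hP : ∀ x y z : P, (x * y - y * x) * z = 0)
    {L : Type*} [LieRing L] [LieAlgebra k L]
    (m : P ⊗[k] L →ₗ[k] P ⊗[k] L →ₗ[k] P ⊗[k] L)
    (hm : ∀ (p q : P) (a b : L), m (p ⊗ₜ[k] a) (q ⊗ₜ[k] b) = (p * q) ⊗ₜ[k] ⁅a, b⁆) :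
    ∀ x y z : P ⊗[k] L, m x (m y z) = m (m x y) z + m y (m x z) := by
  intro x y z
  induction x using TensorProduct.induction_on with
  | zero => simp
  | add x₁ x₂ h₁ h₂ =>
    simp only [map_add, LinearMap.add_apply, h₁, h₂]
    abel
  | tmul p a =>
    induction y using TensorProduct.induction_on with
    | zero => simp
    | add y₁ y₂ h₁ h₂ =>
      simp only [map_add, LinearMap.add_apply, h₁, h₂]
      abel
    | tmul q b =>
      induction z using TensorProduct.induction_on with
      | zero => simp
      | add z₁ z₂ h₁ h₂ =>
        simp only [map_add, h₁, h₂]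
        abel
      | tmul r c =>
        have h : q * (p * r) = p * (q * r) := by
          have h0 := hP p q r
          rw [sub_mul, sub_eq_zero, mul_assoc, mul_assoc] at h0
          exact h0.symm
        rw [hm, hm, hm, hm, hm, hm, h, mul_assoc, ← TensorProduct.tmul_add, leibniz_lie]
end

section
/- (Embedding theorem for dialgebras, P₂ version) Let Ω be a set and let D be a k-vector space (k a field of characteristic zero) equipped with two families of bilinear operations ⊢_ω and ⊣_ω (ω ∈ Ω) satisfying, for all ω, μ ∈ Ω and all x, y, z ∈ D, the identities (x ⊢_ω y − x ⊣_ω y) ⊢_μ z = 0 and x ⊣_μ (y ⊢_ω z − y ⊣_ω z) = 0. Then there exist an Ω-algebra D̂ over k and an injective k-linear map φ : D → P₂ ⊗ D̂ such that φ(a ⊢_ω b) = φ(a) ⊢_ω φ(b) and φ(a ⊣_ω b) = φ(a) ⊣_ω φ(b) for all a, b ∈ D and all ω ∈ Ω, where P₂ ⊗ D̂ carries the operations (p⊗x) ⊢_ω (q⊗y) = pq ⊗ (x ∘_ω y) and (p⊗x) ⊣_ω (q⊗y) = qp ⊗ (x ∘_ω y). Moreover, if D is finite-dimensional then D̂ can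 be chosen with dim D̂ ≤ 2 dim D. -/
open scoped TensorProduct

/-- A bundled `Ω`-algebra over `k`: a `k`-vector space with a family of bilinear
operations indexed by `Ω`. -/
structure OmegaAlgebra (k : Type) [Field k] (Ω : Type) where
  carrier : Type
  [isAddCommGroup : AddCommGroup carrier]
  [isModule : Module k carrier]
  op : Ω → carrier →ₗ[k] carrier →ₗ[k] carrier

attribute [instance] OmegaAlgebra.isAddCommGroup OmegaAlgebra.isModule

/-- Embedding theorem for dialgebras, `P₂` version: any 0-dialgebra `D`
embeds into `P₂ ⊗ D̂` for some `Ω`-algebra `D̂`; moreover `D̂` can be chosen with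
`dim D̂ ≤ 2 dim D` when `D` is finite-dimensional.  Here `P₂ = k × k` with product
`(a,b)(c,d) = (ac, ad)`. -/
theorem stmt10 {k : Type} [Field k] [CharZero k] {Ω : Type}
    {D : Type} [AddCommGroup D] [Module k D]
    (vd dv : Ω → D →ₗ[k] D →ₗ[k] D)
    (h1 : ∀ (ω μ : Ω) (x y z : D), vd μ (vd ω x y - dv ω x y) z = 0)
    (h2 : ∀ (ω μ : Ω) (x y z : D), dv μ x (vd ω y z - dv ω y z) = 0) :
    ∃ (B : OmegaAlgebra k Ω)
      (L R : Ω → (k × k) ⊗[k] B.carrier →ₗ[k] (k × k) ⊗[k] B.carrier →ₗ[k]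
        (k × k) ⊗[k] B.carrier)
      (φ : D →ₗ[k] (k × k) ⊗[k] B.carrier),
      (∀ (ω : Ω) (p q : k × k) (x y : B.carrier),
        L ω (p ⊗ₜ[k] x) (q ⊗ₜ[k] y) = ((p.1 * q.1, p.1 * q.2) : k × k) ⊗ₜ[k] B.op ω x y) ∧
      (∀ (ω : Ω) (p q : k × k) (x y : B.carrier),
        R ω (p ⊗ₜ[k] x) (q ⊗ₜ[k] y) = ((q.1 * p.1, q.1 * p.2) : k × k) ⊗ₜ[k] B.op ω x y) ∧
      Function.Injective φ ∧
      (∀ (ω : Ω) (a b : D), φ (vd ω a b) = L ω (φ a) (φ b)) ∧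
      (∀ (ω : Ω) (a b : D), φ (dv ω a b) = R ω (φ a) (φ b)) ∧
      (FiniteDimensional k D →
        FiniteDimensional k B.carrier ∧
          Module.finrank k B.carrier ≤ 2 * Module.finrank k D) := by
  classical
  let D0 : Submodule k D :=
    Submodule.span k {d | ∃ (ω : Ω) (x y : D), d = vd ω x y - dv ω x y}
  have hmem : ∀ (ω : Ω) (x y : D), vd ω x y - dv ω x y ∈ D0 := fun ω x y =>
    Submodule.subset_span ⟨ω, x, y, rfl⟩
  have hl : ∀ ω, D0 ≤ LinearMap.ker (vd ω) := by
    intro ω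
    refine Submodule.span_le.2 ?_
    rintro _ ⟨μ, x, y, rfl⟩
    refine LinearMap.mem_ker.2 (LinearMap.ext fun z => ?_)
    exact h1 μ ω x y z
  have hr : ∀ ω, D0 ≤ LinearMap.ker (dv ω).flip := by
    intro ω
    refine Submodule.span_le.2 ?_
    rintro _ ⟨μ, x, y, rfl⟩
    refine LinearMap.mem_ker.2 (LinearMap.ext fun z => ?_)
    exact h2 μ ω z x y
  let l : Ω → (D ⧸ D0) →ₗ[k] D →ₗ[k] D := fun ω => D0.liftQ (vd ω) (hl ω)
  let r : Ω → (D ⧸ D0) →ₗ[k] D →ₗ[k] D := fun ω => D0.liftQ (dv ω).flip (hr ω)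
  have hlm : ∀ ω a b, l ω (D0.mkQ a) b = vd ω a b := fun ω a b => rfl
  have hrm : ∀ ω a b, r ω (D0.mkQ b) a = dv ω a b := fun ω a b => rfl
  have hq : ∀ ω a b, D0.mkQ (vd ω a b) = D0.mkQ (dv ω a b) := fun ω a b =>
    (Submodule.Quotient.eq D0).2 (hmem ω a b)
  have hm : ∀ ω, D0 ≤ LinearMap.ker ((l ω).compr₂ D0.mkQ).flip := by
    intro ω d hd
    refine LinearMap.mem_ker.2 (LinearMap.ext fun z => ?_)
    obtain ⟨a, rfl⟩ := D0.mkQ_surjective z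
    have h : dv ω a d = 0 := LinearMap.congr_fun (LinearMap.mem_ker.1 (hr ω hd)) a
    change D0.mkQ (vd ω a d) = 0
    rw [hq, h, map_zero]
  let m : Ω → (D ⧸ D0) →ₗ[k] (D ⧸ D0) →ₗ[k] (D ⧸ D0) := fun ω =>
    D0.liftQ ((l ω).compr₂ D0.mkQ).flip (hm ω)
  have hmm : ∀ ω a b, m ω (D0.mkQ b) (D0.mkQ a) = D0.mkQ (vd ω a b) := fun ω a b => rfl
  let op : Ω → ((D ⧸ D0) × D) →ₗ[k] ((D ⧸ D0) × D) →ₗ[k] ((D ⧸ D0) × D) := fun ω =>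
    LinearMap.mk₂ k (fun u v => (m ω v.1 u.1, l ω u.1 v.2 + r ω v.1 u.2))
      (by intro u u' v; ext <;> simp <;> abel)
      (by intro c u v; ext <;> simp)
      (by intro u v v'; ext <;> simp <;> abel)
      (by intro c u v; ext <;> simp)
  have hop : ∀ ω u v, op ω u v = (m ω v.1 u.1, l ω u.1 v.2 + r ω v.1 u.2) :=
    fun _ _ _ => rfl
  let P : (k × k) →ₗ[k] (k × k) →ₗ[k] (k × k) :=
    LinearMap.mk₂ k (fun p q => (p.1 * q.1, p.1 * q.2))
      (by intro u u' v; ext <;> simp <;> ring)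
      (by intro c u v; ext <;> simp <;> ring)
      (by intro u v v'; ext <;> simp <;> ring)
      (by intro c u v; ext <;> simp <;> ring)
  have hP : ∀ p q, P p q = (p.1 * q.1, p.1 * q.2) := fun _ _ => rfl
  let φ : D →ₗ[k] (k × k) ⊗[k] ((D ⧸ D0) × D) :=
    (TensorProduct.mk k (k × k) ((D ⧸ D0) × D) (1, 0)) ∘ₗ (LinearMap.inl k _ _) ∘ₗ D0.mkQ +
    (TensorProduct.mk k (k × k) ((D ⧸ D0) × D) (0, 1)) ∘ₗ (LinearMap.inr k _ _)
  have hφ : ∀ a, φ a = ((1, 0) : k × k) ⊗ₜ[k] ((D0.mkQ a, 0) : (D ⧸ D0) × D)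
      + ((0, 1) : k × k) ⊗ₜ[k] ((0, a) : (D ⧸ D0) × D) := fun _ => rfl
  have h00 : ((0, 0) : k × k) = 0 := rfl
  refine ⟨⟨(D ⧸ D0) × D, op⟩, fun ω => TensorProduct.map₂ P (op ω),
    fun ω => TensorProduct.map₂ P.flip (op ω), φ, ?_, ?_, ?_, ?_, ?_, ?_⟩
  · intro ω p q x y
    rw [TensorProduct.map₂_apply_tmul, TensorProduct.map_tmul]; rfl
  · intro ω p q x y
    rw [TensorProduct.map₂_apply_tmul, TensorProduct.map_tmul]; rfl
  · let ψ : (k × k) ⊗[k] ((D ⧸ D0) × D) →ₗ[k] D :=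
      (TensorProduct.lid k D).toLinearMap ∘ₗ
        TensorProduct.map (LinearMap.snd k k k) (LinearMap.snd k (D ⧸ D0) D)
    have hψ : ∀ a, ψ (φ a) = a := by
      intro a
      rw [hφ]
      simp [ψ]
    exact Function.LeftInverse.injective hψ
  · intro ω a b
    change φ (vd ω a b) = TensorProduct.map₂ P (op ω) (φ a) (φ b)
    simp only [hφ, map_add, LinearMap.add_apply, TensorProduct.map₂_apply_tmul, TensorProduct.map_tmul, hP, hop,
      hmm, hlm, hrm, map_zero, LinearMap.zero_apply, mul_one, mul_zero, zero_mul, add_zero,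
      zero_add, h00, TensorProduct.zero_tmul]
  · intro ω a b
    change φ (dv ω a b) = TensorProduct.map₂ P.flip (op ω) (φ a) (φ b)
    simp only [hφ, map_add, LinearMap.add_apply, TensorProduct.map₂_apply_tmul, TensorProduct.map_tmul, hP, hop,
      LinearMap.flip_apply,
      hmm, hlm, hrm, hq, map_zero, LinearMap.zero_apply, mul_one, mul_zero, zero_mul, add_zero,
      zero_add, h00, TensorProduct.zero_tmul]
  · intro hfd
    refine ⟨inferInstanceAs (FiniteDimensional k ((D ⧸ D0) × D)), ?_⟩
    change Module.finrank k ((D ⧸ D0) × D) ≤ _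
    rw [Module.finrank_prod]
    have := Submodule.finrank_quotient_le D0
    omega
end
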